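/- arXiv:2201.08768 — 2 statements merged into one kernel-verified Lean document; each statement's English description precedes it below -/
import Mathlib

section
/- Let n ≥ 1 and let A_1, …, A_n, A, B_1, …, B_n, B be positive natural numbers, and let N be a positive real. Set a_i = A_i/N, a = A/N, b_i = B_i/N, b = B/N, p_i = 2(a_i + b_i) and w_i = b_i/p_i for i = 1, …, n, and p_0 = 2a, w_0 = 1. Then for every subset I of {1, …, n}, writing I_0 = I ∪ {0}: (∑_{i∈I} A_i < A and ∑_{i∈I} B_i ≥ B) holds if and only if ((∑_{i∈I_0} p_i·w_i)/(∑_{i∈I_0} p_i) > 1/2 and ∑_{i∈I_0} p_i·w_i ≥ p_0 + b). -/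
open Finset

/-- Knapsack reduction (conditions (*) ⟺ (***)): with `aᵢ = Aᵢ/N`, `a = A/N`,
`bᵢ = Bᵢ/N`, `b = B/N`, `pᵢ = 2(aᵢ + bᵢ)`, `wᵢ = bᵢ/pᵢ`, `p₀ = 2a` and `w₀ = 1`,
for every subset `I` of `{1, …, n}`:
`∑_{i∈I} Aᵢ < A ∧ ∑_{i∈I} Bᵢ ≥ B` iff
`(∑_{i∈I₀} pᵢwᵢ)/(∑_{i∈I₀} pᵢ) > 1/2 ∧ ∑_{i∈I₀} pᵢwᵢ ≥ p₀ + b`,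
where `I₀ = I ∪ {0}`. -/
theorem knapsack_iff_gpr_recall
    (n : ℕ) (hn : 1 ≤ n) (A B : Fin n → ℕ) (A0 B0 : ℕ)
    (hA : ∀ i, 0 < A i) (hB : ∀ i, 0 < B i) (hA0 : 0 < A0) (hB0 : 0 < B0)
    (N : ℝ) (hN : 0 < N)
    (a b p w : Fin n → ℝ) (aa bb p0 w0 : ℝ)
    (ha : ∀ i, a i = (A i : ℝ) / N) (hb : ∀ i, b i = (B i : ℝ) / N)
    (haa : aa = (A0 : ℝ) / N) (hbb : bb = (B0 : ℝ) / N)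
    (hp : ∀ i, p i = 2 * (a i + b i)) (hw : ∀ i, w i = b i / p i)
    (hp0 : p0 = 2 * aa) (hw0 : w0 = 1)
    (I : Finset (Fin n)) :
    ((∑ i ∈ I, A i) < A0 ∧ B0 ≤ ∑ i ∈ I, B i) ↔
      ((p0 * w0 + ∑ i ∈ I, p i * w i) / (p0 + ∑ i ∈ I, p i) > 1 / 2 ∧
        p0 + bb ≤ p0 * w0 + ∑ i ∈ I, p i * w i) := by
  have hpw (i) : p i * w i = b i := by
    have hpi : 0 < p i := by
      have := hA i
      have := hB i
      rw [hp, ha, hb]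
      positivity
    rw [hw, mul_div_cancel₀ _ hpi.ne']
  have hSa : ∑ i ∈ I, a i = ((∑ i ∈ I, A i : ℕ) : ℝ) / N := by
    simp only [ha, Nat.cast_sum, Finset.sum_div]
  have hSb : ∑ i ∈ I, b i = ((∑ i ∈ I, B i : ℕ) : ℝ) / N := by
    simp only [hb, Nat.cast_sum, Finset.sum_div]
  have hSp : ∑ i ∈ I, p i = 2 * (∑ i ∈ I, a i + ∑ i ∈ I, b i) := by
    simp only [hp, ← Finset.mul_sum, Finset.sum_add_distrib]
  have haa_pos : 0 < aa := by
    rw [haa]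
    positivity
  have hSa_nonneg : 0 ≤ ∑ i ∈ I, a i := by
    rw [hSa]
    positivity
  have hSb_nonneg : 0 ≤ ∑ i ∈ I, b i := by
    rw [hSb]
    positivity
  have hA_iff : (∑ i ∈ I, A i) < A0 ↔ ∑ i ∈ I, a i < aa := by
    rw [hSa, haa, div_lt_div_iff_of_pos_right hN, Nat.cast_lt]
  have hB_iff : B0 ≤ ∑ i ∈ I, B i ↔ bb ≤ ∑ i ∈ I, b i := by
    rw [hSb, hbb, div_le_div_iff_of_pos_right hN, Nat.cast_le]
  rw [hA_iff, hB_iff]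
  simp only [hpw]
  rw [hSp, hp0, hw0, mul_one, gt_iff_lt, div_lt_div_iff₀ two_pos (by linarith)]
  refine and_congr ⟨fun h => ?_, fun h => ?_⟩ ⟨fun h => ?_, fun h => ?_⟩ <;> linarith
end

section
/- Let δ, p_0, B be positive reals with δ < 1/2, and set λ = (p_0 + 1/2 − δ)/p_0. Let I be a finite index set, let p_i > 0 and w_i be reals for i ∈ I, and set B_i = (1/δ)·B·p_i·(λ·w_i − 1) for i ∈ I. Then ∑_{i∈I} B_i ≥ B if and only if (p_0 + ∑_{i∈I} p_i·w_i)/(p_0 + 1/2 + ∑_{i∈I} p_i) ≥ 1/λ. -/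
open Finset

/-- Arithmetical core of the NP-hardness proof for the GPR-f-score threshold
problem: with `λ = (p₀ + 1/2 − δ)/p₀` and `Bᵢ = (1/δ)·B·pᵢ·(λwᵢ − 1)`,
`∑_{i∈I} Bᵢ ≥ B` iff `(p₀ + ∑_{i∈I} pᵢwᵢ)/(p₀ + 1/2 + ∑_{i∈I} pᵢ) ≥ 1/λ`. -/
theorem knapsack_iff_gpr_fscore
    {ι : Type*} (δ p0 B : ℝ) (hδ : 0 < δ) (hδhalf : δ < 1 / 2)
    (hp0 : 0 < p0) (hB : 0 < B)
    (l : ℝ) (hl : l = (p0 + 1 / 2 - δ) / p0)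
    (I : Finset ι) (p w : ι → ℝ) (hp : ∀ i ∈ I, 0 < p i)
    (Bfun : ι → ℝ) (hBfun : ∀ i ∈ I, Bfun i = (1 / δ) * B * p i * (l * w i - 1)) :
    B ≤ ∑ i ∈ I, Bfun i ↔
      1 / l ≤ (p0 + ∑ i ∈ I, p i * w i) / (p0 + 1 / 2 + ∑ i ∈ I, p i) := by
  have hP : 0 ≤ ∑ i ∈ I, p i := Finset.sum_nonneg fun i hi => (hp i hi).le
  have hl_pos : 0 < l := by
    rw [hl]
    exact div_pos (by linarith) hp0
  have hl_mul : l * p0 = p0 + 1 / 2 - δ := by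
    rw [hl]
    exact div_mul_cancel₀ _ hp0.ne'
  have hsum : ∑ i ∈ I, Bfun i = B * ((l * ∑ i ∈ I, p i * w i - ∑ i ∈ I, p i) / δ) := by
    rw [Finset.sum_congr rfl hBfun, Finset.mul_sum, ← Finset.sum_sub_distrib,
      Finset.sum_div, Finset.mul_sum]
    exact Finset.sum_congr rfl fun i _ => by ring
  rw [hsum, le_mul_iff_one_le_right hB, one_le_div hδ,
    div_le_div_iff₀ hl_pos (by linarith)]
  constructor <;> intro h <;> linarith
end
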